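/- Let a ≥ 0, γ ≥ 1, and γ < b < 2γ. Then there exists C > 0 such that for any Schwartz function f on ℝ², ∫_{ℝ²} ‖δ_α f + δ_{−α} f‖^{2γ}_{Ḣ^a} |α|^{−2−2b} dα ≤ C ‖f‖^{2γ}_{Ḣ^{a+b/γ}}. -/

import Mathlib

open MeasureTheory FourierTransform

/-- Square of the homogeneous Sobolev norm `‖g‖²_{Ḣ^s}` on `ℝ²`. -/
noncomputable def HsqNorm (s : ℝ) (g : EuclideanSpace ℝ (Fin 2) → ℂ) : ℝ :=
  ∫ ξ : EuclideanSpace ℝ (Fin 2), ‖ξ‖ ^ (2 * s) * ‖𝓕 g ξ‖ ^ 2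

open scoped ENNReal

theorem rpow_lintegral_le {X : Type*} [MeasurableSpace X] (μ : Measure X) {γ : ℝ} (hγ : 1 ≤ γ)
    {w M : X → ℝ≥0∞} (hw : Measurable w) (hM : Measurable M) :
    (∫⁻ x, w x * M x ∂μ) ^ γ ≤ (∫⁻ x, w x ∂μ) ^ (γ - 1) * ∫⁻ x, w x * M x ^ γ ∂μ := by
  have hγ0 : 0 < γ := by linarith
  have h := eLpNorm'_le_eLpNorm'_mul_rpow_measure_univ (μ := μ.withDensity w) zero_lt_one hγ
    hM.aestronglyMeasurable
  simp only [eLpNorm', enorm_eq_self, ENNReal.rpow_one, div_one] at h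
  rw [lintegral_withDensity_eq_lintegral_mul _ hw hM,
    lintegral_withDensity_eq_lintegral_mul _ hw (hM.pow_const γ),
    withDensity_apply _ MeasurableSet.univ, Measure.restrict_univ] at h
  calc _ ≤ _ := ENNReal.rpow_le_rpow h hγ0.le
    _ = _ := by
      rw [ENNReal.mul_rpow_of_nonneg _ _ hγ0.le, ← ENNReal.rpow_mul, ← ENNReal.rpow_mul, mul_comm]
      have h1 : 1 / γ * γ = 1 := by field_simp
      have h2 : (1 - 1 / γ) * γ = γ - 1 := by field_simp
      rw [h1, h2, ENNReal.rpow_one]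
      rfl

theorem fourier_secondDiff {V : Type*} [NormedAddCommGroup V] [InnerProductSpace ℝ V]
    [MeasurableSpace V] [BorelSpace V] [FiniteDimensional ℝ V] {f : V → ℂ} (hf : Integrable f)
    (α ξ : V) :
    𝓕 (fun x => (f x - f (x - α)) + (f x - f (x + α))) ξ =
      ((2 - 2 * Real.cos (2 * Real.pi * inner ℝ α ξ) : ℝ) : ℂ) * 𝓕 f ξ := by
  have tr : ∀ v : V, 𝓕 (fun x => f (x + v)) ξ = 𝐞 (inner ℝ v ξ) • 𝓕 f ξ := fun v =>
    congrFun (VectorFourier.fourierIntegral_comp_add_right 𝐞 volume (innerₗ V) f v) ξ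
  have hadd : ∀ v : V, Integrable (fun x => f (x + v)) := fun v => hf.comp_add_right v
  have key : 𝓕 (fun x => (f x - f (x - α)) + (f x - f (x + α))) ξ =
      (𝓕 f ξ - 𝓕 (fun x => f (x + -α)) ξ) + (𝓕 f ξ - 𝓕 (fun x => f (x + α)) ξ) := by
    have c : ∀ {g : V → ℂ}, Integrable g →
        Integrable (fun v => 𝐞 (-(inner ℝ v ξ)) • g v) := fun hg =>
      (Real.fourierIntegral_convergent_iff ξ).2 hg
    simp only [Real.fourier_eq, sub_eq_add_neg (_ : V) α, smul_add, smul_sub]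
    exact (integral_add ((c hf).sub (c (hadd _))) ((c hf).sub (c (hadd _)))).trans
      (congrArg₂ _ (integral_sub (c hf) (c (hadd _))) (integral_sub (c hf) (c (hadd _))))
  rw [key, tr, tr]
  simp only [Circle.smul_def, Real.fourierChar_apply, smul_eq_mul, inner_neg_left]
  push_cast
  rw [Complex.cos]
  ring_nf

theorem two_sub_two_cos_sq_le {u t : ℝ} (h : |u| ≤ t) :
    (2 - 2 * Real.cos (2 * Real.pi * u)) ^ 2 ≤ min 16 ((2 * Real.pi * t) ^ 4) := by
  have h1 := Real.cos_le_one (2 * Real.pi * u)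
  have h2 := Real.neg_one_le_cos (2 * Real.pi * u)
  have h3 := Real.one_sub_sq_div_two_le_cos (x := 2 * Real.pi * u)
  have h4 : u ^ 2 ≤ t ^ 2 := sq_le_sq' (by linarith [neg_abs_le u]) ((le_abs_self u).trans h)
  refine le_min (by nlinarith) ?_
  calc _ ≤ ((2 * Real.pi * t) ^ 2) ^ 2 := by
        gcongr
        · linarith
        · calc _ ≤ (2 * Real.pi * u) ^ 2 := by linarith
            _ ≤ _ := by rw [mul_pow, mul_pow _ t]; gcongr
    _ = _ := by ring

theorem integrable_rpow_mul_sq_schwartz {V : Type*} [NormedAddCommGroup V] [InnerProductSpace ℝ V]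
    [MeasurableSpace V] [BorelSpace V] [FiniteDimensional ℝ V] (F : SchwartzMap V ℂ) {s : ℝ}
    (hs : 0 ≤ s) : Integrable (fun ξ : V => ‖ξ‖ ^ s * ‖F ξ‖ ^ 2) := by
  obtain ⟨n, hn⟩ := exists_nat_ge s
  obtain ⟨B, hB⟩ : ∃ B, ∀ ξ, ‖F ξ‖ ≤ B := by
    obtain ⟨B, -, hB⟩ := F.decay 0 0
    exact ⟨B, fun ξ => by simpa using hB ξ⟩
  refine Integrable.mono' (((F.integrable.norm).add (F.integrable_pow_mul volume n)).const_mul B)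
    ?_ (.of_forall fun ξ => ?_)
  · exact (Measurable.aestronglyMeasurable (by fun_prop)).mul
      (F.continuous.norm.pow 2).aestronglyMeasurable
  · rw [Real.norm_of_nonneg (by positivity)]
    have h1 : ‖ξ‖ ^ s ≤ 1 + ‖ξ‖ ^ n := by
      rcases le_total ‖ξ‖ 1 with h | h
      · exact (Real.rpow_le_one (norm_nonneg _) h hs).trans (le_add_of_nonneg_right (by positivity))
      · have := Real.rpow_le_rpow_of_exponent_le h hn
        rw [Real.rpow_natCast] at this
        linarith
    calc _ ≤ (1 + ‖ξ‖ ^ n) * (B * ‖F ξ‖) := by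
          rw [sq]; gcongr; exact hB ξ
      _ = _ := by simp only [Pi.add_apply]; ring

theorem integrable_multiplier {γ b : ℝ} (hγ : 0 < γ) (hb0 : 0 < b) (hb : b < 2 * γ) :
    Integrable (fun α : EuclideanSpace ℝ (Fin 2) =>
      (min 16 ((2 * Real.pi * ‖α‖) ^ 4)) ^ γ * ‖α‖ ^ (-(2 + 2 * b))) := by
  rw [integrable_fun_norm_addHaar volume
    (f := fun t : ℝ => (min 16 ((2 * Real.pi * t) ^ 4)) ^ γ * t ^ (-(2 + 2 * b)))]
  simp only [finrank_euclideanSpace, Fintype.card_fin, Nat.add_one_sub_one, pow_one, smul_eq_mul]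
  have hmeas : Measurable fun t : ℝ =>
      t * ((min 16 ((2 * Real.pi * t) ^ 4)) ^ γ * t ^ (-(2 + 2 * b))) := by fun_prop
  have hexp : ∀ {t : ℝ}, 0 < t → t * t ^ (-(2 + 2 * b)) = t ^ (-(1 + 2 * b)) := fun {t} ht => by
    rw [show -(1 + 2 * b) = 1 + -(2 + 2 * b) by ring, Real.rpow_add ht, Real.rpow_one]
  have hnn : ∀ {t : ℝ}, 0 < t →
      ‖t * ((min 16 ((2 * Real.pi * t) ^ 4)) ^ γ * t ^ (-(2 + 2 * b)))‖ =
        (min 16 ((2 * Real.pi * t) ^ 4)) ^ γ * t ^ (-(1 + 2 * b)) := fun {t} ht => by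
    rw [Real.norm_of_nonneg (by positivity), ← hexp ht]; ring
  rw [← Set.Ioc_union_Ioi_eq_Ioi zero_le_one]
  refine IntegrableOn.union ?_ ?_
  · have h1 : IntegrableOn (fun t : ℝ => t ^ (4 * γ - 1 - 2 * b)) (Set.Ioc 0 1) := by
      rw [← intervalIntegrable_iff_integrableOn_Ioc_of_le zero_le_one]
      exact intervalIntegral.intervalIntegrable_rpow' (by linarith)
    refine Integrable.mono' (h1.const_mul (((2 * Real.pi) ^ 4) ^ γ)) hmeas.aestronglyMeasurable
      ((ae_restrict_iff' measurableSet_Ioc).2 (.of_forall fun t ht => ?_))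
    have ht0 : 0 < t := ht.1
    rw [hnn ht0]
    calc _ ≤ ((2 * Real.pi * t) ^ 4) ^ γ * t ^ (-(1 + 2 * b)) := by
          gcongr; exact min_le_right _ _
      _ = _ := by
          rw [mul_pow, Real.mul_rpow (by positivity) (by positivity),
            show 4 * γ - 1 - 2 * b = (4 : ℕ) * γ + -(1 + 2 * b) by push_cast; ring,
            Real.rpow_add ht0, Real.rpow_natCast_mul ht0.le, mul_assoc]
  · have h1 : IntegrableOn (fun t : ℝ => t ^ (-(1 + 2 * b))) (Set.Ioi 1) :=
      integrableOn_Ioi_rpow_of_lt (by linarith) zero_lt_one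
    refine Integrable.mono' (h1.const_mul (16 ^ γ)) hmeas.aestronglyMeasurable
      ((ae_restrict_iff' measurableSet_Ioi).2 (.of_forall fun t ht => ?_))
    have ht0 : 0 < t := zero_lt_one.trans ht
    rw [hnn ht0]
    gcongr
    exact min_le_left _ _

theorem lintegral_multiplier_le {γ b : ℝ} (hγ : 0 < γ) (hb0 : 0 < b) (hb : b < 2 * γ)
    (ξ : EuclideanSpace ℝ (Fin 2)) :
    ∫⁻ α : EuclideanSpace ℝ (Fin 2),
      ENNReal.ofReal (‖ξ‖ ^ (-(2 * b / γ)) * min 16 ((2 * Real.pi * (‖ξ‖ * ‖α‖)) ^ 4)) ^ γ *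
        ENNReal.ofReal (‖α‖ ^ (-(2 + 2 * b))) ≤
    ENNReal.ofReal (∫ α : EuclideanSpace ℝ (Fin 2),
      (min 16 ((2 * Real.pi * ‖α‖) ^ 4)) ^ γ * ‖α‖ ^ (-(2 + 2 * b))) := by
  rcases eq_or_ne ξ 0 with rfl | hξ
  · simp [hγ]
  have hr : 0 < ‖ξ‖ := norm_pos_iff.2 hξ
  set G : EuclideanSpace ℝ (Fin 2) → ℝ := fun α =>
    (min 16 ((2 * Real.pi * ‖α‖) ^ 4)) ^ γ * ‖α‖ ^ (-(2 + 2 * b)) with hG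
  have hGi : Integrable G := integrable_multiplier hγ hb0 hb
  have key : ∀ α : EuclideanSpace ℝ (Fin 2),
      ENNReal.ofReal (‖ξ‖ ^ (-(2 * b / γ)) * min 16 ((2 * Real.pi * (‖ξ‖ * ‖α‖)) ^ 4)) ^ γ *
        ENNReal.ofReal (‖α‖ ^ (-(2 + 2 * b))) = ENNReal.ofReal (‖ξ‖ ^ 2 * G (‖ξ‖ • α)) := by
    intro α
    rw [ENNReal.ofReal_rpow_of_nonneg (by positivity) hγ.le, ← ENNReal.ofReal_mul (by positivity)]
    congr 1
    have e1 : -(2 * b / γ) * γ = 2 + -(2 + 2 * b) := by field_simp; ring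
    simp only [hG, norm_smul, norm_norm]
    rw [Real.mul_rpow (by positivity) (by positivity), ← Real.rpow_mul hr.le, e1,
      Real.rpow_add hr, Real.rpow_two, Real.mul_rpow hr.le (norm_nonneg α)]
    ring
  simp_rw [key]
  rw [← ofReal_integral_eq_lintegral_ofReal ((hGi.comp_smul hr.ne').const_mul _)
    (.of_forall fun α => by simp only [hG, Pi.zero_apply]; positivity),
    integral_const_mul, Measure.integral_comp_smul]
  refine (congrArg ENNReal.ofReal ?_).le
  rw [finrank_euclideanSpace, Fintype.card_fin, abs_of_nonneg (by positivity), smul_eq_mul,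
    mul_inv_cancel_left₀ (by positivity)]

theorem ofReal_integral_le_lintegral {X : Type*} [MeasurableSpace X] {μ : Measure X} {f : X → ℝ}
    (hf : ∀ x, 0 ≤ f x) : ENNReal.ofReal (∫ x, f x ∂μ) ≤ ∫⁻ x, ENNReal.ofReal (f x) ∂μ := by
  have h := enorm_integral_le_lintegral_enorm (μ := μ) f
  rw [Real.enorm_of_nonneg (integral_nonneg hf)] at h
  simpa only [Real.enorm_of_nonneg (hf _)] using h

theorem HsqNorm_nonneg (s : ℝ) (g : EuclideanSpace ℝ (Fin 2) → ℂ) : 0 ≤ HsqNorm s g :=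
  integral_nonneg fun _ => by positivity

theorem ofReal_HsqNorm_secondDiff_le {a c : ℝ}
    (f : SchwartzMap (EuclideanSpace ℝ (Fin 2)) ℂ) (α : EuclideanSpace ℝ (Fin 2)) :
    ENNReal.ofReal (HsqNorm a (fun x => (f x - f (x - α)) + (f x - f (x + α)))) ≤
      ∫⁻ ξ : EuclideanSpace ℝ (Fin 2),
        ENNReal.ofReal (‖ξ‖ ^ (2 * (a + c)) * ‖𝓕 f ξ‖ ^ 2) *
          ENNReal.ofReal (‖ξ‖ ^ (-(2 * c)) * min 16 ((2 * Real.pi * (‖ξ‖ * ‖α‖)) ^ 4)) := by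
  refine (ofReal_integral_le_lintegral fun ξ => by positivity).trans (lintegral_mono fun ξ => ?_)
  rw [← ENNReal.ofReal_mul (by positivity), fourier_secondDiff f.integrable, norm_mul, mul_pow,
    Complex.norm_real, Real.norm_eq_abs, sq_abs, ← SchwartzMap.fourier_coe]
  refine ENNReal.ofReal_le_ofReal ?_
  rcases eq_or_ne ξ 0 with rfl | hξ
  · simp
  have hr : 0 < ‖ξ‖ := norm_pos_iff.2 hξ
  have hm : (2 - 2 * Real.cos (2 * Real.pi * inner ℝ α ξ)) ^ 2 ≤
      min 16 ((2 * Real.pi * (‖ξ‖ * ‖α‖)) ^ 4) :=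
    two_sub_two_cos_sq_le ((abs_real_inner_le_norm α ξ).trans_eq (mul_comm _ _))
  calc _ ≤ ‖ξ‖ ^ (2 * a) * (min 16 ((2 * Real.pi * (‖ξ‖ * ‖α‖)) ^ 4) * ‖𝓕 f ξ‖ ^ 2) := by gcongr
    _ = _ := by
      rw [show 2 * a = 2 * (a + c) + -(2 * c) by ring, Real.rpow_add hr]
      ring

theorem stmt_11 (a γ b : ℝ) (ha : 0 ≤ a) (hγ : 1 ≤ γ) (hγb : γ < b) (hb : b < 2 * γ) :
    ∃ C : ℝ, 0 < C ∧ ∀ f : SchwartzMap (EuclideanSpace ℝ (Fin 2)) ℂ,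
      (∫ α : EuclideanSpace ℝ (Fin 2),
          (HsqNorm a (fun x => (f x - f (x - α)) + (f x - f (x + α)))) ^ γ *
            ‖α‖ ^ (-(2 + 2 * b))) ≤
        C * (HsqNorm (a + b / γ) ⇑f) ^ γ := by
  have hγ0 : 0 < γ := by linarith
  have hb0 : 0 < b := by linarith
  set K : ℝ := ∫ α : EuclideanSpace ℝ (Fin 2),
    (min 16 ((2 * Real.pi * ‖α‖) ^ 4)) ^ γ * ‖α‖ ^ (-(2 + 2 * b))
  have hK0 : 0 ≤ K := integral_nonneg fun α => by positivity
  refine ⟨K + 1, by positivity, fun f => ?_⟩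
  set N := HsqNorm (a + b / γ) ⇑f
  have hN0 : 0 ≤ N := HsqNorm_nonneg _ _
  suffices h : (∫ α : EuclideanSpace ℝ (Fin 2),
      (HsqNorm a (fun x => (f x - f (x - α)) + (f x - f (x + α)))) ^ γ *
        ‖α‖ ^ (-(2 + 2 * b))) ≤ K * N ^ γ from
    h.trans (by gcongr; linarith)
  rw [← ENNReal.ofReal_le_ofReal_iff (by positivity)]
  have hpos : ∀ α, 0 ≤ HsqNorm a (fun x => (f x - f (x - α)) + (f x - f (x + α))) :=
    fun α => HsqNorm_nonneg _ _
  let W : EuclideanSpace ℝ (Fin 2) → ℝ≥0∞ := fun ξ =>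
    ENNReal.ofReal (‖ξ‖ ^ (2 * (a + b / γ)) * ‖𝓕 f ξ‖ ^ 2)
  let M : EuclideanSpace ℝ (Fin 2) → EuclideanSpace ℝ (Fin 2) → ℝ≥0∞ := fun α ξ =>
    ENNReal.ofReal (‖ξ‖ ^ (-(2 * b / γ)) * min 16 ((2 * Real.pi * (‖ξ‖ * ‖α‖)) ^ 4))
  let k : EuclideanSpace ℝ (Fin 2) → ℝ≥0∞ := fun α => ENNReal.ofReal (‖α‖ ^ (-(2 + 2 * b)))
  have hWm : Measurable W := by
    have := (𝓕 f).continuous.measurable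
    fun_prop
  have hMm : Measurable (Function.uncurry M) := by
    simp only [M, Function.uncurry_def]
    fun_prop
  have hkm : Measurable k := by fun_prop
  have hM : ∀ α, Measurable (M α) := fun α => hMm.of_uncurry_left
  have hWN : ∫⁻ ξ, W ξ = ENNReal.ofReal N :=
    (ofReal_integral_eq_lintegral_ofReal
      (integrable_rpow_mul_sq_schwartz (𝓕 f) (by positivity))
      (.of_forall fun ξ => by simp only [Pi.zero_apply]; positivity)).symm
  have hH : ∀ α, ENNReal.ofReal
      (HsqNorm a (fun x => (f x - f (x - α)) + (f x - f (x + α)))) ≤ ∫⁻ ξ, W ξ * M α ξ := by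
    intro α
    simpa only [W, M, mul_div_assoc] using ofReal_HsqNorm_secondDiff_le (a := a) (c := b / γ) f α
  calc _ ≤ ∫⁻ α, ENNReal.ofReal ((HsqNorm a
          (fun x => (f x - f (x - α)) + (f x - f (x + α)))) ^ γ * ‖α‖ ^ (-(2 + 2 * b))) :=
        ofReal_integral_le_lintegral fun α =>
          mul_nonneg (Real.rpow_nonneg (hpos α) _) (by positivity)
    _ ≤ ∫⁻ α, ENNReal.ofReal N ^ (γ - 1) * ∫⁻ ξ, W ξ * (M α ξ ^ γ * k α) := by
        refine lintegral_mono fun α => ?_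
        rw [ENNReal.ofReal_mul (Real.rpow_nonneg (hpos α) _),
          ← ENNReal.ofReal_rpow_of_nonneg (hpos α) hγ0.le]
        simp_rw [← mul_assoc]
        rw [lintegral_mul_const (f := fun ξ => W ξ * M α ξ ^ γ) _ (hWm.mul ((hM α).pow_const γ)),
          ← mul_assoc, ← hWN]
        gcongr
        exact (ENNReal.rpow_le_rpow (hH α) hγ0.le).trans (rpow_lintegral_le _ hγ hWm (hM α))
    _ = ENNReal.ofReal N ^ (γ - 1) * ∫⁻ ξ, W ξ * ∫⁻ α, M α ξ ^ γ * k α := by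
        rw [lintegral_const_mul' _ _ (by finiteness [sub_nonneg.2 hγ]),
          lintegral_lintegral_swap]
        · congr 1
          refine lintegral_congr fun ξ => lintegral_const_mul _ ?_
          exact ((hMm.of_uncurry_right (y := ξ)).pow_const γ).mul hkm
        · exact ((hWm.comp measurable_snd).mul
            ((hMm.pow_const γ).mul (hkm.comp measurable_fst))).aemeasurable
    _ ≤ ENNReal.ofReal N ^ (γ - 1) * ∫⁻ ξ, W ξ * ENNReal.ofReal K := by
        gcongr with ξ
        exact lintegral_multiplier_le hγ0 hb0 hb ξ
    _ = ENNReal.ofReal (K * N ^ γ) := by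
        rw [lintegral_mul_const _ hWm, hWN, ← mul_assoc, ENNReal.ofReal_mul hK0,
          ← ENNReal.ofReal_rpow_of_nonneg hN0 hγ0.le, mul_comm]
        congr 1
        nth_rewrite 2 [← ENNReal.rpow_one (ENNReal.ofReal N)]
        rw [← ENNReal.rpow_add_of_nonneg _ _ (by linarith) zero_le_one, sub_add_cancel]
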